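/- arXiv:2110.13493 — 5 statements merged into one kernel-verified Lean document; each statement's English description precedes it below -/
import Mathlib

section
/- Let n ≥ 1 and let 0 < a ≤ b < ∞. For every f ∈ L¹(ℝⁿ) one has ‖M_a^b f‖_{L¹(ℝⁿ)} ≤ (1 + n·ln(b/a))·‖f‖_{L¹(ℝⁿ)}, i.e. the truncated Hardy–Littlewood maximal operator M_a^b is bounded on L¹(ℝⁿ) with norm at most 1 + n·ln(b/a). -/
open MeasureTheory Metric Set ENNReal NNReal

/-- The truncated Hardy–Littlewood maximal operator
`M_a^b f(x) = sup_{a<r<b} (1/|B(x,r)|) ∫_{B(x,r)} |f(y)| dy` on `ℝⁿ`. -/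
noncomputable def truncMax (n : ℕ) (a b : ℝ) (f : EuclideanSpace ℝ (Fin n) → ℝ)
    (x : EuclideanSpace ℝ (Fin n)) : ℝ≥0∞ :=
  ⨆ r ∈ Set.Ioo a b,
    (volume (Metric.ball x r))⁻¹ * ∫⁻ y in Metric.ball x r, (‖f y‖₊ : ℝ≥0∞)

/-- The radial profile `t ↦ max(a, t)⁻ⁿ` on `t < b`; up to the volume of the unit ball, it dominates
the kernels of all averages over balls of radius `r ∈ (a, b)`. -/
noncomputable def truncProfile (n : ℕ) (a b : ℝ) : ℝ → ℝ :=
  (Set.Iio b).indicator fun t => (max a t ^ n)⁻¹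

theorem truncProfile_nonneg (n : ℕ) {a : ℝ} (b : ℝ) (ha : 0 < a) (t : ℝ) :
    0 ≤ truncProfile n a b t :=
  Set.indicator_nonneg (fun t _ => by have : 0 < max a t := lt_max_of_lt_left ha; positivity) t

theorem measurable_truncProfile (n : ℕ) (a b : ℝ) : Measurable (truncProfile n a b) :=
  Measurable.indicator (by fun_prop) measurableSet_Iio

theorem integral_pow_mul_inv_max_pow {n : ℕ} (hn : 1 ≤ n) {a b : ℝ} (ha : 0 < a) (hab : a ≤ b) :
    ∫ t in (0 : ℝ)..b, t ^ (n - 1) * (max a t ^ n)⁻¹ = (n : ℝ)⁻¹ + Real.log (b / a) := by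
  have hcont : Continuous fun t : ℝ => t ^ (n - 1) * (max a t ^ n)⁻¹ := by
    refine (continuous_pow _).mul (Continuous.inv₀ (by fun_prop) fun t => ?_)
    exact (pow_pos (lt_max_of_lt_left ha) n).ne'
  rw [← intervalIntegral.integral_add_adjacent_intervals (hcont.intervalIntegrable 0 a)
    (hcont.intervalIntegrable a b)]
  congr 1
  · have : ∫ t in (0 : ℝ)..a, t ^ (n - 1) * (max a t ^ n)⁻¹
        = ∫ t in (0 : ℝ)..a, t ^ (n - 1) * (a ^ n)⁻¹ := by
      refine intervalIntegral.integral_congr fun t ht => ?_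
      rw [Set.uIcc_of_le ha.le] at ht
      simp only [max_eq_left ht.2]
    obtain ⟨m, rfl⟩ := Nat.exists_eq_add_of_le' hn
    rw [this, intervalIntegral.integral_mul_const, integral_pow]
    simp only [Nat.add_sub_cancel]
    push_cast
    field_simp
    simp
  · rw [← integral_inv_of_pos ha (ha.trans_le hab)]
    refine intervalIntegral.integral_congr fun t ht => ?_
    rw [Set.uIcc_of_le hab] at ht
    have ht0 : t ≠ 0 := (ha.trans_le ht.1).ne'
    obtain ⟨m, rfl⟩ := Nat.exists_eq_add_of_le' hn
    simp only [max_eq_right ht.1, Nat.add_sub_cancel, pow_succ]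
    field_simp

theorem setIntegral_pow_mul_truncProfile {n : ℕ} (hn : 1 ≤ n) {a b : ℝ} (ha : 0 < a)
    (hab : a ≤ b) :
    ∫ t in Set.Ioi (0 : ℝ), t ^ (n - 1) * truncProfile n a b t
      = (n : ℝ)⁻¹ + Real.log (b / a) := by
  rw [← integral_pow_mul_inv_max_pow hn ha hab, intervalIntegral.integral_of_le (ha.trans_le hab).le,
    integral_Ioc_eq_integral_Ioo, ← Set.Ioi_inter_Iio, ← setIntegral_indicator measurableSet_Iio]
  refine integral_congr_ae (Filter.Eventually.of_forall fun t => ?_)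
  simp only [truncProfile, Set.indicator_apply]
  split_ifs <;> simp

section Haar

variable {E : Type*} [NormedAddCommGroup E] [NormedSpace ℝ E] [FiniteDimensional ℝ E]
  [MeasurableSpace E] [BorelSpace E] (μ : Measure E) [μ.IsAddHaarMeasure]

theorem integrable_truncProfile_norm {a : ℝ} (b : ℝ) (ha : 0 < a) :
    Integrable (fun x : E => truncProfile (Module.finrank ℝ E) a b ‖x‖) μ := by
  have hind : (fun x : E => truncProfile (Module.finrank ℝ E) a b ‖x‖)
      = (ball (0 : E) b).indicator fun x => (max a ‖x‖ ^ Module.finrank ℝ E)⁻¹ := by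
    ext x
    by_cases hx : ‖x‖ < b <;> simp [truncProfile, Set.indicator, hx]
  rw [hind, integrable_indicator_iff measurableSet_ball]
  refine Measure.integrableOn_of_bounded (M := (a ^ Module.finrank ℝ E)⁻¹)
    measure_ball_lt_top.ne (by fun_prop) (Filter.Eventually.of_forall fun x => ?_)
  have hmax : 0 < max a ‖x‖ := lt_max_of_lt_left ha
  rw [Real.norm_of_nonneg (by positivity)]
  gcongr
  exact le_max_left _ _

variable [Nontrivial E]

theorem integral_truncProfile_norm {a b : ℝ} (ha : 0 < a) (hab : a ≤ b) :
    ∫ x, truncProfile (Module.finrank ℝ E) a b ‖x‖ ∂μ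
      = μ.real (ball 0 1) * (1 + Module.finrank ℝ E * Real.log (b / a)) := by
  have hn : 1 ≤ Module.finrank ℝ E := Module.finrank_pos
  have hn' : (Module.finrank ℝ E : ℝ) ≠ 0 := by positivity
  rw [integral_fun_norm_addHaar]
  simp only [smul_eq_mul, nsmul_eq_mul]
  rw [setIntegral_pow_mul_truncProfile hn ha hab]
  field_simp

theorem lintegral_truncProfile_norm {a b : ℝ} (ha : 0 < a) (hab : a ≤ b) :
    (μ (ball 0 1))⁻¹ * ∫⁻ x, ENNReal.ofReal (truncProfile (Module.finrank ℝ E) a b ‖x‖) ∂μ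
      = ENNReal.ofReal (1 + Module.finrank ℝ E * Real.log (b / a)) := by
  have h0 : μ (ball 0 1) ≠ 0 := (measure_ball_pos μ 0 one_pos).ne'
  rw [← ofReal_integral_eq_lintegral_ofReal (integrable_truncProfile_norm μ b ha)
    (Filter.Eventually.of_forall fun x => truncProfile_nonneg _ b ha _),
    integral_truncProfile_norm μ ha hab, ENNReal.ofReal_mul measureReal_nonneg,
    ofReal_measureReal measure_ball_lt_top.ne, ← mul_assoc,
    ENNReal.inv_mul_cancel h0 measure_ball_lt_top.ne, one_mul]

theorem inv_measure_ball_le_truncProfile {a b r : ℝ} (ha : 0 < a) (hr : r ∈ Set.Ioo a b) (x : E)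
    {y : E} (hy : y ∈ ball x r) :
    (μ (ball x r))⁻¹
      ≤ (μ (ball 0 1))⁻¹ * ENNReal.ofReal (truncProfile (Module.finrank ℝ E) a b ‖x - y‖) := by
  have hr0 : 0 < r := ha.trans hr.1
  have hxy : ‖x - y‖ < r := by rwa [← dist_eq_norm, dist_comm]
  have hmax : 0 < max a ‖x - y‖ := lt_max_of_lt_left ha
  rw [Measure.addHaar_ball μ x hr0.le, ENNReal.mul_inv (.inr measure_ball_lt_top.ne)
    (.inl ENNReal.ofReal_ne_top), mul_comm, ← ENNReal.ofReal_inv_of_pos (by positivity),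
    truncProfile, Set.indicator_of_mem (Set.mem_Iio.2 (hxy.trans hr.2))]
  gcongr
  exact max_le hr.1.le hxy.le

end Haar

theorem truncMax_le_lintegral {n : ℕ} (hn : 1 ≤ n) {a : ℝ} (b : ℝ) (ha : 0 < a)
    (f : EuclideanSpace ℝ (Fin n) → ℝ) (x : EuclideanSpace ℝ (Fin n)) :
    truncMax n a b f x ≤ ∫⁻ y, (volume (ball (0 : EuclideanSpace ℝ (Fin n)) 1))⁻¹ *
      ENNReal.ofReal (truncProfile n a b ‖x - y‖) * (‖f y‖₊ : ℝ≥0∞) := by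
  have : Nonempty (Fin n) := ⟨⟨0, hn⟩⟩
  refine iSup₂_le fun r hr => ?_
  have hfin : (volume (ball x r))⁻¹ ≠ ∞ :=
    ENNReal.inv_ne_top.2 (measure_ball_pos volume x (ha.trans hr.1)).ne'
  rw [← lintegral_const_mul' _ _ hfin]
  refine (setLIntegral_mono' measurableSet_ball fun y hy => ?_).trans (setLIntegral_le_lintegral _ _)
  gcongr
  simpa using inv_measure_ball_le_truncProfile volume ha hr x hy

/-- For `0 < a ≤ b < ∞`, the truncated Hardy–Littlewood maximal operator is bounded
on `L¹(ℝⁿ)` with norm at most `1 + n·ln(b/a)`. -/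
theorem truncMax_l1_bound (n : ℕ) (hn : 1 ≤ n) (a b : ℝ) (ha : 0 < a) (hab : a ≤ b)
    (f : EuclideanSpace ℝ (Fin n) → ℝ) (hf : Integrable f) :
    ∫⁻ x, truncMax n a b f x ≤
      ENNReal.ofReal (1 + n * Real.log (b / a)) * ∫⁻ x, (‖f x‖₊ : ℝ≥0∞) := by
  have : Nonempty (Fin n) := ⟨⟨0, hn⟩⟩
  have hprofile := measurable_truncProfile n a b
  have hf' : AEMeasurable fun y => (‖f y‖₊ : ℝ≥0∞) := hf.1.aemeasurable.nnnorm.coe_nnreal_ennreal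
  have hc : (volume (ball (0 : EuclideanSpace ℝ (Fin n)) 1))⁻¹ ≠ ∞ :=
    ENNReal.inv_ne_top.2 (measure_ball_pos volume _ one_pos).ne'
  refine (lintegral_mono (truncMax_le_lintegral hn b ha f)).trans_eq ?_
  rw [lintegral_lintegral_swap
      (by exact AEMeasurable.mul (Measurable.aemeasurable (by fun_prop)) hf'.comp_snd),
    ← lintegral_const_mul'' _ hf']
  refine lintegral_congr fun y => ?_
  rw [lintegral_mul_const' _ _ ENNReal.coe_ne_top, lintegral_const_mul' _ _ hc,
    lintegral_sub_right_eq_self (fun x => ENNReal.ofReal (truncProfile n a b ‖x‖)) y]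
  congr 1
  simpa using lintegral_truncProfile_norm
    (volume : Measure (EuclideanSpace ℝ (Fin n))) ha hab
end

section
/- Let n ≥ 1 and let a = (a₁,…,aₙ), b = (b₁,…,bₙ) ∈ ℝⁿ with 0 < aᵢ ≤ bᵢ < ∞ for all i. For every f ∈ L¹(ℝⁿ) one has ‖M_a^b f‖_{L¹(ℝⁿ)} ≤ (∏_{i=1}^n (1 + ln(bᵢ/aᵢ)))·‖f‖_{L¹(ℝⁿ)}, where M_a^b is the strong truncated Hardy–Littlewood maximal operator. -/
open MeasureTheory Metric Set ENNReal NNReal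

/-- The strong truncated Hardy–Littlewood maximal operator on `ℝⁿ`:
`M_a^b f(x) = sup (1/|R|) ∫_R |f|`, the sup over axis-parallel rectangles
`R = ∏ (xᵢ − rᵢ, xᵢ + rᵢ)` centered at `x` with `aᵢ < rᵢ < bᵢ`. -/
noncomputable def strongTruncMax (n : ℕ) (a b : Fin n → ℝ) (f : (Fin n → ℝ) → ℝ)
    (x : Fin n → ℝ) : ℝ≥0∞ :=
  ⨆ (r : Fin n → ℝ) (_ : ∀ i, r i ∈ Set.Ioo (a i) (b i)),
    (volume (Set.univ.pi fun i => Set.Ioo (x i - r i) (x i + r i)))⁻¹ *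
      ∫⁻ y in Set.univ.pi fun i => Set.Ioo (x i - r i) (x i + r i), (‖f y‖₊ : ℝ≥0∞)

/-- The pointwise supremum over `a < r < b` of the one-dimensional averaging kernels
`(2r)⁻¹ 1_{(-r, r)}`. -/
noncomputable def truncKernel (a b t : ℝ) : ℝ :=
  (Ioo (-b) b).indicator (fun t => (2 * max a |t|)⁻¹) t

lemma truncKernel_nonneg {a : ℝ} (ha : 0 < a) (b t : ℝ) : 0 ≤ truncKernel a b t := by
  unfold truncKernel
  exact indicator_nonneg (fun _ _ => by positivity) _

lemma continuous_inv_two_mul_max_abs {a : ℝ} (ha : 0 < a) :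
    Continuous fun t : ℝ => (2 * max a |t|)⁻¹ :=
  Continuous.inv₀ (by fun_prop) fun t => by positivity

lemma measurable_truncKernel {a : ℝ} (ha : 0 < a) (b : ℝ) : Measurable (truncKernel a b) :=
  (continuous_inv_two_mul_max_abs ha).measurable.indicator measurableSet_Ioo

lemma integrable_truncKernel {a : ℝ} (ha : 0 < a) (b : ℝ) : Integrable (truncKernel a b) :=
  (((continuous_inv_two_mul_max_abs ha).integrableOn_Icc).mono_set
    Ioo_subset_Icc_self).integrable_indicator measurableSet_Ioo

lemma inv_two_mul_le_truncKernel {a b r t : ℝ} (ha : 0 < a) (hr : r ∈ Ioo a b)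
    (ht : t ∈ Ioo (-r) r) : (2 * r)⁻¹ ≤ truncKernel a b t := by
  have htb : t ∈ Ioo (-b) b := ⟨by linarith [ht.1, hr.2], ht.2.trans hr.2⟩
  have hmax : max a |t| ≤ r := max_le hr.1.le (abs_lt.2 ht).le
  rw [truncKernel, indicator_of_mem htb]
  gcongr

lemma integral_truncKernel {a b : ℝ} (ha : 0 < a) (hab : a ≤ b) :
    ∫ t, truncKernel a b t = 1 + Real.log (b / a) := by
  have hb : 0 < b := ha.trans_le hab
  have habs : ∀ t, truncKernel a b t = truncKernel a b |t| := fun t => by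
    simp [truncKernel, indicator, ← abs_lt]
  have hint : ∀ c d, IntervalIntegrable (fun t : ℝ => (2 * max a |t|)⁻¹) volume c d := fun c d =>
    (continuous_inv_two_mul_max_abs ha).intervalIntegrable c d
  have hinner : ∫ t in (0 : ℝ)..a, (2 * max a |t|)⁻¹ = 1 / 2 := by
    have : EqOn (fun t : ℝ => (2 * max a |t|)⁻¹) (fun _ => (2 * a)⁻¹) (uIcc 0 a) := by
      intro t ht
      rw [uIcc_of_le ha.le] at ht
      simp [abs_of_nonneg ht.1, max_eq_left ht.2]
    rw [intervalIntegral.integral_congr this, intervalIntegral.integral_const]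
    simp only [smul_eq_mul]
    field_simp
    ring
  have houter : ∫ t in a..b, (2 * max a |t|)⁻¹ = 1 / 2 * Real.log (b / a) := by
    have : EqOn (fun t : ℝ => (2 * max a |t|)⁻¹) (fun t => 1 / 2 * t⁻¹) (uIcc a b) := by
      intro t ht
      rw [uIcc_of_le hab] at ht
      simp [abs_of_nonneg (ha.le.trans ht.1), max_eq_right ht.1, mul_comm]
    rw [intervalIntegral.integral_congr this, intervalIntegral.integral_const_mul,
      integral_inv_of_pos ha hb]
  calc ∫ t, truncKernel a b t = ∫ t, truncKernel a b |t| := by simp_rw [← habs]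
    _ = 2 * ∫ t in Ioi (0 : ℝ), truncKernel a b t := integral_comp_abs
    _ = 2 * ∫ t in (0 : ℝ)..b, (2 * max a |t|)⁻¹ := by
      have hset : Ioi (0 : ℝ) ∩ Ioo (-b) b = Ioo 0 b := by
        ext t
        simp only [mem_inter_iff, mem_Ioi, mem_Ioo]
        exact ⟨fun h => ⟨h.1, h.2.2⟩, fun h => ⟨h.1, by linarith [h.1], h.2⟩⟩
      unfold truncKernel
      rw [setIntegral_indicator measurableSet_Ioo, hset,
        intervalIntegral.integral_of_le hb.le, integral_Ioc_eq_integral_Ioo]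
    _ = 1 + Real.log (b / a) := by
      rw [← intervalIntegral.integral_add_adjacent_intervals (hint 0 a) (hint a b), hinner, houter]
      ring

lemma lintegral_prod_truncKernel {ι : Type*} [Fintype ι] {a b : ι → ℝ}
    (ha : ∀ i, 0 < a i) (hab : ∀ i, a i ≤ b i) :
    ∫⁻ x : ι → ℝ, ENNReal.ofReal (∏ i, truncKernel (a i) (b i) (x i)) =
      ENNReal.ofReal (∏ i, (1 + Real.log (b i / a i))) := by
  rw [← ofReal_integral_eq_lintegral_ofReal (μ := volume)
      (Integrable.fintype_prod fun i => integrable_truncKernel (ha i) (b i))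
      (ae_of_all _ fun x => Finset.prod_nonneg fun i _ => truncKernel_nonneg (ha i) _ _),
    integral_fintype_prod_volume_eq_prod fun i => truncKernel (a i) (b i)]
  simp_rw [integral_truncKernel (ha _) (hab _)]

lemma strongTruncMax_le_lintegral_truncKernel {n : ℕ} {a : Fin n → ℝ} (ha : ∀ i, 0 < a i)
    (b : Fin n → ℝ) (f : (Fin n → ℝ) → ℝ) (x : Fin n → ℝ) :
    strongTruncMax n a b f x ≤
      ∫⁻ y, ENNReal.ofReal (∏ i, truncKernel (a i) (b i) (x i - y i)) * (‖f y‖₊ : ℝ≥0∞) := by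
  refine iSup₂_le fun r hr => ?_
  have hr0 : ∀ i, 0 < r i := fun i => (ha i).trans (hr i).1
  have hmeas : MeasurableSet (univ.pi fun i => Ioo (x i - r i) (x i + r i)) :=
    MeasurableSet.univ_pi fun i => measurableSet_Ioo
  have hvol : (volume (univ.pi fun i => Ioo (x i - r i) (x i + r i)))⁻¹ =
      ENNReal.ofReal (∏ i, (2 * r i)⁻¹) := by
    have hwidth : ∀ i, x i + r i - (x i - r i) = 2 * r i := fun i => by ring
    simp_rw [Real.volume_pi_Ioo, hwidth]
    rw [← ENNReal.ofReal_prod_of_nonneg fun i _ => (mul_pos two_pos (hr0 i)).le,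
      ← ENNReal.ofReal_inv_of_pos (Finset.prod_pos fun i _ => mul_pos two_pos (hr0 i)),
      Finset.prod_inv_distrib]
  rw [hvol, ← lintegral_const_mul' _ _ ENNReal.ofReal_ne_top]
  refine (setLIntegral_mono' hmeas fun y hy => ?_).trans (setLIntegral_le_lintegral _ _)
  gcongr with i
  · exact fun i _ => (inv_pos.2 (mul_pos two_pos (hr0 i))).le
  · have hyi := hy i (mem_univ i)
    exact inv_two_mul_le_truncKernel (ha i) (hr i)
      ⟨by linarith [hyi.2], by linarith [hyi.1]⟩

/-- For `0 < aᵢ ≤ bᵢ < ∞`, the strong truncated Hardy–Littlewood maximal operator is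
bounded on `L¹(ℝⁿ)` with norm at most `∏ᵢ (1 + ln(bᵢ/aᵢ))`. -/
theorem strongTruncMax_l1_bound (n : ℕ) (hn : 1 ≤ n) (a b : Fin n → ℝ)
    (ha : ∀ i, 0 < a i) (hab : ∀ i, a i ≤ b i)
    (f : (Fin n → ℝ) → ℝ) (hf : Integrable f) :
    ∫⁻ x, strongTruncMax n a b f x ≤
      ENNReal.ofReal (∏ i, (1 + Real.log (b i / a i))) * ∫⁻ x, (‖f x‖₊ : ℝ≥0∞) := by
  have hmeas : Measurable fun z : Fin n → ℝ =>
      ENNReal.ofReal (∏ i, truncKernel (a i) (b i) (z i)) :=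
    (Finset.measurable_fun_prod _ fun i _ =>
      (measurable_truncKernel (ha i) (b i)).comp (measurable_pi_apply i)).ennreal_ofReal
  calc ∫⁻ x, strongTruncMax n a b f x
      ≤ ∫⁻ x, ∫⁻ y, ENNReal.ofReal (∏ i, truncKernel (a i) (b i) ((x - y) i)) *
          (‖f y‖₊ : ℝ≥0∞) :=
        lintegral_mono fun x => strongTruncMax_le_lintegral_truncKernel ha b f x
    _ = ∫⁻ y, ∫⁻ x, ENNReal.ofReal (∏ i, truncKernel (a i) (b i) ((x - y) i)) *
          (‖f y‖₊ : ℝ≥0∞) :=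
        lintegral_lintegral_swap <|
          (hmeas.comp (measurable_fst.sub measurable_snd)).aemeasurable.mul
            hf.aestronglyMeasurable.enorm.comp_snd
    _ = ∫⁻ y, ENNReal.ofReal (∏ i, (1 + Real.log (b i / a i))) * (‖f y‖₊ : ℝ≥0∞) := by
        refine lintegral_congr fun y => ?_
        rw [lintegral_mul_const' _ _ ENNReal.coe_ne_top,
          lintegral_sub_right_eq_self
            (fun z : Fin n → ℝ => ENNReal.ofReal (∏ i, truncKernel (a i) (b i) (z i))) y,
          lintegral_prod_truncKernel ha hab]
    _ = _ := lintegral_const_mul' _ _ ENNReal.ofReal_ne_top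
end

section
/- Let n ≥ 1 and 0 < a ≤ b < ∞. Let O₁,…,O_N be pairwise disjoint rectangles in ℝⁿ such that each O_j is a translate of O₁, and let α₁,…,α_N ≥ 0. Set f = ∑_{j=1}^N α_j·χ_{O_j} and g = (∑_{j=1}^N α_j)·χ_{O₁}. Then ‖f‖_{L¹(ℝⁿ)} = ‖g‖_{L¹(ℝⁿ)} and ‖M_a^b f‖_{L¹(ℝⁿ)} ≤ ‖M_a^b g‖_{L¹(ℝⁿ)}. -/
open MeasureTheory Metric Set ENNReal NNReal Function

theorem lowerSemicontinuous_measure_ball {X : Type*} [PseudoMetricSpace X] [MeasurableSpace X]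
    (μ : Measure X) (r : ℝ) : LowerSemicontinuous fun x => μ (ball x r) := by
  intro x c hc
  change c < μ (ball x r) at hc
  obtain ⟨u, hum, hur, hu⟩ := exists_seq_strictMono_tendsto r
  have hU : ball x r = ⋃ k, ball x (u k) := by
    ext y
    simp only [mem_ball, mem_iUnion]
    exact ⟨fun h => (hu.eventually_const_lt h).exists, fun ⟨k, hk⟩ => hk.trans (hur k)⟩
  have hmono : Monotone fun k => ball x (u k) := fun i j hij => ball_subset_ball (hum.monotone hij)
  rw [hU, hmono.measure_iUnion, lt_iSup_iff] at hc
  obtain ⟨k, hk⟩ := hc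
  filter_upwards [ball_mem_nhds x (sub_pos.2 (hur k))] with y hy
  refine hk.trans_le (measure_mono (ball_subset_ball' ?_))
  rw [mem_ball, dist_comm] at hy
  linarith

theorem measurable_truncMax (n : ℕ) (a b : ℝ) (f : EuclideanSpace ℝ (Fin n) → ℝ) :
    Measurable (truncMax n a b f) := by
  have h : truncMax n a b f = fun x => ⨆ r ∈ Set.Ioo a b,
      ((volume (ball (0 : EuclideanSpace ℝ (Fin n)) r))⁻¹ •
        volume.withDensity fun y => (‖f y‖₊ : ℝ≥0∞)) (ball x r) := by
    funext x
    simp only [truncMax, Measure.smul_apply, smul_eq_mul, withDensity_apply _ measurableSet_ball,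
      Measure.addHaar_ball_center volume x]
  rw [h]
  exact (lowerSemicontinuous_biSup fun r _ => lowerSemicontinuous_measure_ball _ r).measurable

theorem truncMax_finset_sum_le {ι : Type*} (s : Finset ι) (n : ℕ) (a b : ℝ)
    (f : ι → EuclideanSpace ℝ (Fin n) → ℝ) (hf : ∀ j ∈ s, Measurable (f j))
    (x : EuclideanSpace ℝ (Fin n)) :
    truncMax n a b (fun y => ∑ j ∈ s, f j y) x ≤ ∑ j ∈ s, truncMax n a b (f j) x := by
  refine iSup₂_le fun r hr => ?_
  calc
    _ ≤ (volume (ball x r))⁻¹ * ∫⁻ y in ball x r, ∑ j ∈ s, (‖f j y‖₊ : ℝ≥0∞) := by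
      gcongr with y
      exact_mod_cast nnnorm_sum_le s fun j => f j y
    _ = ∑ j ∈ s, (volume (ball x r))⁻¹ * ∫⁻ y in ball x r, (‖f j y‖₊ : ℝ≥0∞) := by
      rw [lintegral_finsetSum s fun j hj => (hf j hj).nnnorm.coe_nnreal_ennreal, Finset.mul_sum]
    _ ≤ _ := Finset.sum_le_sum fun j _ => le_iSup₂_of_le r hr le_rfl

theorem truncMax_const_mul (n : ℕ) (a b c : ℝ) (f : EuclideanSpace ℝ (Fin n) → ℝ)
    (x : EuclideanSpace ℝ (Fin n)) :
    truncMax n a b (fun y => c * f y) x = ‖c‖₊ * truncMax n a b f x := by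
  simp only [truncMax, nnnorm_mul, ENNReal.coe_mul, ENNReal.mul_iSup,
    lintegral_const_mul' _ _ coe_ne_top, mul_left_comm]

theorem truncMax_comp_sub (n : ℕ) (a b : ℝ) (f : EuclideanSpace ℝ (Fin n) → ℝ)
    (v x : EuclideanSpace ℝ (Fin n)) :
    truncMax n a b (fun y => f (y - v)) x = truncMax n a b f (x - v) := by
  have h (r : ℝ) : ∫⁻ y in ball x r, (‖f (y - v)‖₊ : ℝ≥0∞) =
      ∫⁻ y in ball (x - v) r, (‖f y‖₊ : ℝ≥0∞) := by
    rw [← lintegral_indicator measurableSet_ball, ← lintegral_indicator measurableSet_ball,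
      ← lintegral_sub_right_eq_self ((ball (x - v) r).indicator _) v]
    congr 1 with y
    simp [indicator]
  simp only [truncMax, h, Measure.addHaar_ball_center volume x,
    Measure.addHaar_ball_center volume (x - v)]

/-- If `O₁,…,O_N` are pairwise disjoint axis-parallel rectangles in `ℝⁿ`, each a
translate of `O₁`, `α_j ≥ 0`, `f = ∑ α_j χ_{O_j}` and `g = (∑ α_j) χ_{O₁}`, then
`‖f‖₁ = ‖g‖₁` and `‖M_a^b f‖₁ ≤ ‖M_a^b g‖₁`. -/
theorem truncMax_rearrangement (n N : ℕ) (hn : 1 ≤ n) (hN : 0 < N)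
    (a b : ℝ) (ha : 0 < a) (hab : a ≤ b)
    (O : Fin N → Set (EuclideanSpace ℝ (Fin n)))
    (hbox : ∀ j, ∃ lo hi : Fin n → ℝ,
      O j = {y : EuclideanSpace ℝ (Fin n) | ∀ i, lo i < y i ∧ y i < hi i})
    (htrans : ∀ j, ∃ v : EuclideanSpace ℝ (Fin n),
      O j = (fun y => v + y) '' O ⟨0, hN⟩)
    (hdisj : Pairwise (Disjoint on O))
    (α : Fin N → ℝ) (hα : ∀ j, 0 ≤ α j)
    (f g : EuclideanSpace ℝ (Fin n) → ℝ)
    (hf : f = fun y => ∑ j, (O j).indicator (fun _ => α j) y)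
    (hg : g = (O ⟨0, hN⟩).indicator fun _ => ∑ j, α j) :
    (∫⁻ x, (‖f x‖₊ : ℝ≥0∞)) = (∫⁻ x, (‖g x‖₊ : ℝ≥0∞)) ∧
    (∫⁻ x, truncMax n a b f x) ≤ ∫⁻ x, truncMax n a b g x := by
  have hmeas (j) : MeasurableSet (O j) := by
    obtain ⟨lo, hi, h⟩ := hbox j
    rw [h]
    measurability
  set χ : Fin N → EuclideanSpace ℝ (Fin n) → ℝ := fun j => (O j).indicator 1 with hχ
  have hχm (j) : Measurable (χ j) := measurable_one.indicator (hmeas j)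
  have hχ0 (j y) : 0 ≤ χ j y := indicator_nonneg (fun _ _ => zero_le_one) y
  have hf' : f = fun y => ∑ j, α j * χ j y := by
    simp [hf, hχ, indicator]
  have hg' : g = fun y => (∑ j, α j) * χ ⟨0, hN⟩ y := by
    ext y
    simp [hg, hχ, indicator]
  have hsum : (‖∑ j, α j‖₊ : ℝ≥0∞) = ∑ j, (‖α j‖₊ : ℝ≥0∞) := by
    simp only [← enorm_eq_nnnorm, Real.enorm_of_nonneg (hα _),
      Real.enorm_of_nonneg (Finset.sum_nonneg fun j _ => hα j)]
    exact ENNReal.ofReal_sum_of_nonneg fun j _ => hα j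
  have htr (j) : ∃ v, χ j = fun y => χ ⟨0, hN⟩ (y - v) := by
    obtain ⟨v, hv⟩ := htrans j
    refine ⟨v, ?_⟩
    ext y
    have hy : y ∈ O j ↔ y - v ∈ O ⟨0, hN⟩ := by
      rw [hv]
      simp [image_add_left, sub_eq_neg_add]
    by_cases h : y ∈ O j
    · simp [hχ, h, hy.1 h]
    · simp [hχ, h, mt hy.2 h]
  have hL1 (j) : ∫⁻ y, (‖χ j y‖₊ : ℝ≥0∞) = ∫⁻ y, (‖χ ⟨0, hN⟩ y‖₊ : ℝ≥0∞) := by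
    obtain ⟨v, hv⟩ := htr j
    rw [hv]
    exact lintegral_sub_right_eq_self (fun y => (‖χ ⟨0, hN⟩ y‖₊ : ℝ≥0∞)) v
  have hM (j) : ∫⁻ y, truncMax n a b (χ j) y = ∫⁻ y, truncMax n a b (χ ⟨0, hN⟩) y := by
    obtain ⟨v, hv⟩ := htr j
    rw [hv]
    simp only [truncMax_comp_sub]
    exact lintegral_sub_right_eq_self (truncMax n a b (χ ⟨0, hN⟩)) v
  constructor
  · have hfn (y) : (‖f y‖₊ : ℝ≥0∞) = ∑ j, (‖α j‖₊ : ℝ≥0∞) * ‖χ j y‖₊ := by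
      have h0 (j) : 0 ≤ α j * χ j y := mul_nonneg (hα j) (hχ0 j y)
      simp only [hf', ← enorm_eq_nnnorm, ← enorm_mul,
        Real.enorm_of_nonneg (h0 _), Real.enorm_of_nonneg (Finset.sum_nonneg fun j _ => h0 j)]
      exact ENNReal.ofReal_sum_of_nonneg fun j _ => h0 j
    simp only [hfn]
    rw [lintegral_finsetSum _ fun j _ => (hχm j).nnnorm.coe_nnreal_ennreal.const_mul _]
    simp only [hg', nnnorm_mul, ENNReal.coe_mul, lintegral_const_mul' _ _ coe_ne_top, hL1,
      ← Finset.sum_mul, ← hsum]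
  · calc
      _ ≤ ∫⁻ x, ∑ j, (‖α j‖₊ : ℝ≥0∞) * truncMax n a b (χ j) x := by
        refine lintegral_mono fun x => ?_
        simp only [← truncMax_const_mul]
        rw [hf']
        exact truncMax_finset_sum_le _ n a b _ (fun j _ => (hχm j).const_mul _) x
      _ = ∫⁻ x, truncMax n a b g x := by
        rw [lintegral_finsetSum _ fun j _ => (measurable_truncMax n a b _).const_mul _]
        simp only [hg', truncMax_const_mul, lintegral_const_mul' _ _ coe_ne_top, hM,
          ← Finset.sum_mul, ← hsum]
end

section
/- Let n ≥ 1, 0 < a ≤ b < ∞, and let Q ⊂ ℝⁿ be the cube centered at the origin with side length 2s, where 0 < s < a/(2√n). Let g = c·χ_Q for some constant c ≥ 0. Then: (i) for every x with |x| ≤ a + √n·s one has M_a^b g(x) ≤ ‖g‖_{L¹}/(Vₙ·aⁿ); (ii) for every x with a + √n·s < |x| ≤ b + √n·s one has M_a^b g(x) ≤ ‖g‖_{L¹}/(Vₙ·(|x| − √n·s)ⁿ); (iii) for every x with |x| > b + √n·s one has M_a^b g(x) = 0. Here Vₙ is the volume of the unit ball in ℝⁿ. -/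
open MeasureTheory Metric Set ENNReal NNReal

theorem ballAverage_le_of_le {n : ℕ} {t r : ℝ} (ht : 0 < t) (htr : t ≤ r)
    (f : EuclideanSpace ℝ (Fin n) → ℝ) (x : EuclideanSpace ℝ (Fin n)) :
    (volume (Metric.ball x r))⁻¹ * ∫⁻ y in Metric.ball x r, (‖f y‖₊ : ℝ≥0∞) ≤
      (∫⁻ y, (‖f y‖₊ : ℝ≥0∞)) /
        ENNReal.ofReal ((volume (Metric.ball (0 : EuclideanSpace ℝ (Fin n)) 1)).toReal
          * t ^ n) := by
  have hvol : ENNReal.ofReal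
      ((volume (Metric.ball (0 : EuclideanSpace ℝ (Fin n)) 1)).toReal * t ^ n) ≤
      volume (Metric.ball x r) := by
    rw [Measure.addHaar_ball_of_pos volume x (ht.trans_le htr), finrank_euclideanSpace_fin,
      ENNReal.ofReal_mul ENNReal.toReal_nonneg, ENNReal.ofReal_toReal measure_ball_lt_top.ne,
      mul_comm]
    gcongr
  rw [ENNReal.div_eq_inv_mul]
  gcongr
  exact Measure.restrict_le_self

theorem setLIntegral_ball_eq_zero {n : ℕ} {R r : ℝ} {f : EuclideanSpace ℝ (Fin n) → ℝ}
    (hf : ∀ y, f y ≠ 0 → ‖y‖ ≤ R) {x : EuclideanSpace ℝ (Fin n)} (hx : r + R ≤ ‖x‖) :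
    ∫⁻ y in Metric.ball x r, (‖f y‖₊ : ℝ≥0∞) = 0 := by
  refine setLIntegral_eq_zero measurableSet_ball fun y hy => ?_
  have hfy : f y = 0 := by
    by_contra h
    have h₁ := hf y h
    have h₂ : ‖x - y‖ < r := by rwa [Metric.mem_ball', dist_eq_norm] at hy
    linarith [norm_le_norm_add_norm_sub' x y]
  simp [hfy]

theorem EuclideanSpace.norm_le_sqrt_mul_of_forall_abs_le {n : ℕ} {s : ℝ} (hs : 0 ≤ s)
    {y : EuclideanSpace ℝ (Fin n)} (hy : ∀ i, |y i| ≤ s) : ‖y‖ ≤ Real.sqrt n * s := by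
  rw [EuclideanSpace.norm_eq, Real.sqrt_le_left (by positivity), mul_pow,
    Real.sq_sqrt n.cast_nonneg]
  calc ∑ i, ‖y i‖ ^ 2 ≤ ∑ _i : Fin n, s ^ 2 := by
        gcongr with i
        exact hy i
    _ = n * s ^ 2 := by simp

/-- Pointwise estimates for `M_a^b g` where `g = c·χ_Q` and `Q` is the cube centered
at the origin of side length `2s`, `0 < s < a/(2√n)`:
(i) `M_a^b g(x) ≤ ‖g‖₁/(Vₙ aⁿ)` for `|x| ≤ a + √n·s`;
(ii) `M_a^b g(x) ≤ ‖g‖₁/(Vₙ (|x| − √n·s)ⁿ)` for `a + √n·s < |x| ≤ b + √n·s`;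
(iii) `M_a^b g(x) = 0` for `|x| > b + √n·s`. -/
theorem truncMax_cube_estimates (n : ℕ) (hn : 1 ≤ n) (a b s c : ℝ)
    (ha : 0 < a) (hab : a ≤ b) (hc : 0 ≤ c)
    (hs : 0 < s) (hs' : s < a / (2 * Real.sqrt n))
    (Q : Set (EuclideanSpace ℝ (Fin n)))
    (hQ : Q = {y : EuclideanSpace ℝ (Fin n) | ∀ i, |y i| ≤ s})
    (g : EuclideanSpace ℝ (Fin n) → ℝ) (hg : g = Q.indicator fun _ => c) :
    (∀ x : EuclideanSpace ℝ (Fin n), ‖x‖ ≤ a + Real.sqrt n * s →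
      truncMax n a b g x ≤ (∫⁻ y, (‖g y‖₊ : ℝ≥0∞)) /
        ENNReal.ofReal ((volume (Metric.ball (0 : EuclideanSpace ℝ (Fin n)) 1)).toReal
          * a ^ n)) ∧
    (∀ x : EuclideanSpace ℝ (Fin n),
      a + Real.sqrt n * s < ‖x‖ → ‖x‖ ≤ b + Real.sqrt n * s →
      truncMax n a b g x ≤ (∫⁻ y, (‖g y‖₊ : ℝ≥0∞)) /
        ENNReal.ofReal ((volume (Metric.ball (0 : EuclideanSpace ℝ (Fin n)) 1)).toReal
          * (‖x‖ - Real.sqrt n * s) ^ n)) ∧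
    (∀ x : EuclideanSpace ℝ (Fin n), b + Real.sqrt n * s < ‖x‖ →
      truncMax n a b g x = 0) := by
  have hsupp : ∀ y, g y ≠ 0 → ‖y‖ ≤ Real.sqrt n * s := by
    intro y hy
    have hyQ : y ∈ Q := by
      rw [hg] at hy
      exact Set.mem_of_indicator_ne_zero hy
    rw [hQ] at hyQ
    exact EuclideanSpace.norm_le_sqrt_mul_of_forall_abs_le hs.le hyQ
  refine ⟨fun x _ => iSup₂_le fun r hr => ballAverage_le_of_le ha hr.1.le g x,
    fun x hx _ => iSup₂_le fun r _ => ?_, fun x hx => ?_⟩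
  · rcases le_total (‖x‖ - Real.sqrt n * s) r with h | h
    · exact ballAverage_le_of_le (by linarith) h g x
    · rw [setLIntegral_ball_eq_zero hsupp (by linarith), mul_zero]
      exact zero_le
  · refine le_antisymm (iSup₂_le fun r hr => ?_) zero_le
    rw [setLIntegral_ball_eq_zero hsupp (by linarith [hr.2]), mul_zero]
end

section
/- Let a = (a₁,a₂), b = (b₁,b₂) with 0 < aᵢ ≤ bᵢ < ∞, and on ℝ² let M_a^b be the strong truncated Hardy–Littlewood maximal operator. Let 0 < s < min(a₁,a₂)/4, let Q ⊂ ℝ² be the square centered at the origin with side length 2s, and g = c·χ_Q for a constant c ≥ 0. Then: (i) for x ∈ [−a₁−s, a₁+s] × [−a₂−s, a₂+s], M_a^b g(x) ≤ ‖g‖_{L¹}/(4a₁a₂); (ii) for x with |x₁| ∈ (a₁+s, b₁+s] and |x₂| ≤ a₂+s, M_a^b g(x) ≤ ‖g‖_{L¹}/(4a₂(|x₁| − s)); (iii) for x with |x₁| ≤ a₁+s and |x₂| ∈ (a₂+s, b₂+s], M_a^b g(x) ≤ ‖g‖_{L¹}/(4a₁(|x₂| − s)); (iv) for x with |x₁|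 ∈ (a₁+s, b₁+s] and |x₂| ∈ (a₂+s, b₂+s], M_a^b g(x) ≤ ‖g‖_{L¹}/(4(|x₁| − s)(|x₂| − s)); (v) M_a^b g(x) = 0 whenever |x₁| > b₁+s or |x₂| > b₂+s. -/
open MeasureTheory Metric Set ENNReal NNReal

/-- The strong truncated Hardy–Littlewood maximal operator on `ℝ²`:
`M_a^b f(x) = sup_{r₁∈(a₁,b₁), r₂∈(a₂,b₂)} (1/(4r₁r₂))
  ∫_{[x₁−r₁,x₁+r₁]×[x₂−r₂,x₂+r₂]} |f(y)| dy`. -/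
noncomputable def strongTruncMax2 (a₁ a₂ b₁ b₂ : ℝ) (f : ℝ × ℝ → ℝ) (x : ℝ × ℝ) :
    ℝ≥0∞ :=
  ⨆ r₁ ∈ Set.Ioo a₁ b₁, ⨆ r₂ ∈ Set.Ioo a₂ b₂,
    (ENNReal.ofReal (4 * r₁ * r₂))⁻¹ *
      ∫⁻ y in Set.Icc (x.1 - r₁) (x.1 + r₁) ×ˢ Set.Icc (x.2 - r₂) (x.2 + r₂),
        (‖f y‖₊ : ℝ≥0∞)

/-- If the integration rectangle misses the square, the truncated integral vanishes. -/
theorem setLIntegral_square_eq_zero {s c r₁ r₂ : ℝ} {x : ℝ × ℝ}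
    (h : r₁ < |x.1| - s ∨ r₂ < |x.2| - s) :
    ∫⁻ y in Icc (x.1 - r₁) (x.1 + r₁) ×ˢ Icc (x.2 - r₂) (x.2 + r₂),
      (‖(Icc (-s) s ×ˢ Icc (-s) s).indicator (fun _ => c) y‖₊ : ℝ≥0∞) = 0 := by
  refine setLIntegral_eq_zero (measurableSet_Icc.prod measurableSet_Icc) ?_
  rintro ⟨u, v⟩ ⟨⟨hu, hu'⟩, hv, hv'⟩
  dsimp only at hu hu' hv hv'
  suffices (u, v) ∉ Icc (-s) s ×ˢ Icc (-s) s by simp only [indicator_of_notMem this]; simp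
  rintro ⟨⟨hsu, hsu'⟩, hsv, hsv'⟩
  dsimp only at hsu hsu' hsv hsv'
  rcases h with h | h
  · exact absurd (abs_le.2 ⟨by linarith, by linarith⟩ : |x.1| ≤ r₁ + s) (by linarith)
  · exact absurd (abs_le.2 ⟨by linarith, by linarith⟩ : |x.2| ≤ r₂ + s) (by linarith)

/-- If all radii whose rectangle meets the square are at least `A₁`, `A₂`, then the maximal
function is bounded by the `L¹` norm over `4 A₁ A₂`. -/
theorem strongTruncMax2_square_le {a₁ a₂ b₁ b₂ s c A₁ A₂ : ℝ} {x : ℝ × ℝ}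
    (hA₁ : 0 ≤ A₁) (hA₂ : 0 ≤ A₂)
    (h₁ : ∀ r, a₁ < r → |x.1| - s ≤ r → A₁ ≤ r)
    (h₂ : ∀ r, a₂ < r → |x.2| - s ≤ r → A₂ ≤ r) :
    strongTruncMax2 a₁ a₂ b₁ b₂ ((Icc (-s) s ×ˢ Icc (-s) s).indicator fun _ => c) x ≤
      (∫⁻ y, (‖(Icc (-s) s ×ˢ Icc (-s) s).indicator (fun _ => c) y‖₊ : ℝ≥0∞)) /
        ENNReal.ofReal (4 * A₁ * A₂) := by
  refine iSup₂_le fun r₁ hr₁ => iSup₂_le fun r₂ hr₂ => ?_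
  by_cases h : r₁ < |x.1| - s ∨ r₂ < |x.2| - s
  · rw [setLIntegral_square_eq_zero h, mul_zero]
    exact zero_le
  push Not at h
  have hAr₁ := h₁ r₁ hr₁.1 h.1
  have hAr₂ := h₂ r₂ hr₂.1 h.2
  rw [ENNReal.div_eq_inv_mul]
  have hr₁_nonneg : 0 ≤ r₁ := hA₁.trans hAr₁
  gcongr
  exact Measure.restrict_le_self

/-- Pointwise estimates for `M_a^b g` on `ℝ²`, where `g = c·χ_Q` and `Q` is the
square centered at the origin with side length `2s`, `0 < s < min(a₁,a₂)/4`. -/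
theorem strongTruncMax2_square_estimates (a₁ a₂ b₁ b₂ s c : ℝ)
    (ha₁ : 0 < a₁) (ha₂ : 0 < a₂) (hab₁ : a₁ ≤ b₁) (hab₂ : a₂ ≤ b₂)
    (hc : 0 ≤ c) (hs : 0 < s) (hs' : s < min a₁ a₂ / 4)
    (Q : Set (ℝ × ℝ)) (hQ : Q = Set.Icc (-s) s ×ˢ Set.Icc (-s) s)
    (g : ℝ × ℝ → ℝ) (hg : g = Q.indicator fun _ => c) :
    (∀ x : ℝ × ℝ, |x.1| ≤ a₁ + s → |x.2| ≤ a₂ + s →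
      strongTruncMax2 a₁ a₂ b₁ b₂ g x ≤
        (∫⁻ y, (‖g y‖₊ : ℝ≥0∞)) / ENNReal.ofReal (4 * a₁ * a₂)) ∧
    (∀ x : ℝ × ℝ, a₁ + s < |x.1| → |x.1| ≤ b₁ + s → |x.2| ≤ a₂ + s →
      strongTruncMax2 a₁ a₂ b₁ b₂ g x ≤
        (∫⁻ y, (‖g y‖₊ : ℝ≥0∞)) / ENNReal.ofReal (4 * a₂ * (|x.1| - s))) ∧
    (∀ x : ℝ × ℝ, |x.1| ≤ a₁ + s → a₂ + s < |x.2| → |x.2| ≤ b₂ + s →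
      strongTruncMax2 a₁ a₂ b₁ b₂ g x ≤
        (∫⁻ y, (‖g y‖₊ : ℝ≥0∞)) / ENNReal.ofReal (4 * a₁ * (|x.2| - s))) ∧
    (∀ x : ℝ × ℝ, a₁ + s < |x.1| → |x.1| ≤ b₁ + s →
        a₂ + s < |x.2| → |x.2| ≤ b₂ + s →
      strongTruncMax2 a₁ a₂ b₁ b₂ g x ≤
        (∫⁻ y, (‖g y‖₊ : ℝ≥0∞)) /
          ENNReal.ofReal (4 * (|x.1| - s) * (|x.2| - s))) ∧
    (∀ x : ℝ × ℝ, b₁ + s < |x.1| ∨ b₂ + s < |x.2| →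
      strongTruncMax2 a₁ a₂ b₁ b₂ g x = 0) := by
  subst hQ hg
  refine ⟨fun x _ _ => ?_, fun x h _ _ => ?_, fun x _ h _ => ?_, fun x h _ h' _ => ?_,
    fun x h => ?_⟩
  · exact strongTruncMax2_square_le ha₁.le ha₂.le (fun _ h _ => h.le) fun _ h _ => h.le
  · rw [mul_right_comm]
    exact strongTruncMax2_square_le (by linarith) ha₂.le (fun _ _ h => h) fun _ h _ => h.le
  · exact strongTruncMax2_square_le ha₁.le (by linarith) (fun _ h _ => h.le) fun _ _ h => h
  · exact strongTruncMax2_square_le (by linarith) (by linarith) (fun _ _ h => h) fun _ _ h => h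
  · simp only [strongTruncMax2, ENNReal.iSup_eq_zero]
    intro r₁ hr₁ r₂ hr₂
    rw [setLIntegral_square_eq_zero, mul_zero]
    exact h.imp (fun h => by linarith [hr₁.2]) fun h => by linarith [hr₂.2]
end
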